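/- arXiv:2405.15172 — 2 statements merged into one kernel-verified Lean document; each statement's English description precedes it below -/
import Mathlib

section
/- Let 𝒜 be a finite set with at least two elements, let Θ be an arbitrary nonempty set, and let π : Θ → Δ^{|𝒜|−1} be any map into the interior of the probability simplex on 𝒜 (i.e. π_a(θ) > 0 for every a ∈ 𝒜 and θ ∈ Θ, and Σ_{a∈𝒜} π_a(θ) = 1). Then there exist functions B_a : Θ → ℝ (a ∈ 𝒜) and a random vector C = (C_a)_{a∈𝒜} of real-valued random variables on some probability space such that for every θ ∈ Θ the maximizer of a ↦ B_a(θ) − C_a over 𝒜 is almost surely unique, and for every θ ∈ Θ and a ∈ 𝒜, ℙ(a = argmax_{a'∈𝒜} (B_{a'}(θ) − C_{a'})) = π_a(θ). -/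
open MeasureTheory

open ProbabilityTheory

lemma expMeasure_Ioi {r x : ℝ} (hr : 0 < r) (hx : 0 ≤ x) :
    expMeasure r (Set.Ioi x) = ENNReal.ofReal (Real.exp (-(r * x))) := by
  have := isProbabilityMeasure_expMeasure hr
  rw [← Set.compl_Iic, ← ofReal_measureReal, probReal_compl_eq_one_sub measurableSet_Iic,
    ← cdf_eq_real, cdf_expMeasure_eq hr, if_pos hx, sub_sub_cancel]

lemma ae_pos_expMeasure {r : ℝ} (hr : 0 < r) : ∀ᵐ x ∂expMeasure r, 0 < x := by
  have := isProbabilityMeasure_expMeasure hr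
  have h : expMeasure r (Set.Ioi 0) = 1 := by simp [expMeasure_Ioi hr le_rfl]
  exact (mem_ae_iff_prob_eq_one measurableSet_Ioi).2 h

lemma lintegral_exp_neg_mul_expMeasure {r s : ℝ} (hr : 0 < r) (hs : 0 ≤ s) :
    ∫⁻ x, ENNReal.ofReal (Real.exp (-(s * x))) ∂expMeasure r = ENNReal.ofReal (r / (r + s)) := by
  have hrs : 0 < r + s := by positivity
  have hpdf : Measurable (exponentialPDF r) := (measurable_exponentialPDFReal r).ennreal_ofReal
  change ∫⁻ x, _ ∂(volume.withDensity (exponentialPDF r)) = _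
  rw [lintegral_withDensity_eq_lintegral_mul _ hpdf (by fun_prop)]
  have h (x : ℝ) : (exponentialPDF r * fun x ↦ ENNReal.ofReal (Real.exp (-(s * x)))) x =
      ENNReal.ofReal (r / (r + s)) * exponentialPDF (r + s) x := by
    rcases lt_or_ge x 0 with hx | hx
    · simp [exponentialPDF_of_neg hx]
    · rw [Pi.mul_apply, exponentialPDF_of_nonneg hx, exponentialPDF_of_nonneg hx,
        ← ENNReal.ofReal_mul (by positivity), ← ENNReal.ofReal_mul (by positivity), mul_assoc,
        ← Real.exp_add, ← mul_assoc, div_mul_cancel₀ _ hrs.ne']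
      ring_nf
  simp_rw [h]
  rw [lintegral_const_mul' _ _ ENNReal.ofReal_ne_top, lintegral_exponentialPDF_eq_one hrs, mul_one]

/-- The exponential race: among independent standard exponential times `ω j` run at speeds `p j`,
the time `i` is strictly first with probability proportional to `p i`. -/
lemma pi_expMeasure_race {n : ℕ} (p : Fin (n + 1) → ℝ) (hp : ∀ j, 0 < p j) (i : Fin (n + 1)) :
    Measure.pi (fun _ ↦ expMeasure 1) {ω : Fin (n + 1) → ℝ | ∀ j ≠ i, ω i / p i < ω j / p j} =
      ENNReal.ofReal (p i / ∑ j, p j) := by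
  have := isProbabilityMeasure_expMeasure one_pos
  let T : Set (ℝ × (Fin n → ℝ)) := {z | ∀ j, p (i.succAbove j) / p i * z.1 < z.2 j}
  have hT : MeasurableSet T := by
    simp only [T, Set.ofPred_forall]
    exact .iInter fun j ↦ measurableSet_lt (by fun_prop) (by fun_prop)
  have hpre : {ω : Fin (n + 1) → ℝ | ∀ j ≠ i, ω i / p i < ω j / p j} =
      MeasurableEquiv.piFinSuccAbove (fun _ ↦ ℝ) i ⁻¹' T := by
    ext ω
    simp only [Set.mem_ofPred_eq, Set.mem_preimage, T, i.forall_iff_succAbove, ne_eq,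
      not_true_eq_false, false_imp_iff, true_and, Fin.succAbove_ne, not_false_eq_true,
      true_imp_iff]
    refine forall_congr' fun j ↦ ?_
    change _ ↔ p (i.succAbove j) / p i * ω i < ω (i.succAbove j)
    rw [lt_div_iff₀ (hp _), mul_comm, div_mul_eq_mul_div, mul_div_assoc]
  rw [hpre, (measurePreserving_piFinSuccAbove (fun _ ↦ expMeasure 1) i).measure_preimage
    hT.nullMeasurableSet, Measure.prod_apply hT]
  have hslice : ∀ᵐ x ∂expMeasure 1,
      Measure.pi (fun _ : Fin n ↦ expMeasure 1) (Prod.mk x ⁻¹' T) =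
        ENNReal.ofReal (Real.exp (-((∑ j, p (i.succAbove j) / p i) * x))) := by
    filter_upwards [ae_pos_expMeasure one_pos] with x hx
    have hbox : Prod.mk x ⁻¹' T =
        Set.univ.pi fun j ↦ Set.Ioi (p (i.succAbove j) / p i * x) := by
      ext y
      simp [T]
    have hnn (j : Fin n) : 0 ≤ p (i.succAbove j) / p i * x :=
      mul_nonneg (div_nonneg (hp _).le (hp _).le) hx.le
    rw [hbox, Measure.pi_pi]
    simp_rw [fun j ↦ expMeasure_Ioi one_pos (hnn j)]
    rw [← ENNReal.ofReal_prod_of_nonneg fun _ _ ↦ (Real.exp_pos _).le, ← Real.exp_sum,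
      Finset.sum_neg_distrib, Finset.sum_mul]
    simp
  rw [lintegral_congr_ae hslice, lintegral_exp_neg_mul_expMeasure one_pos
    (Finset.sum_nonneg fun j _ ↦ div_nonneg (hp _).le (hp _).le), Fin.sum_univ_succAbove p i,
    ← Finset.sum_div]
  have := hp i
  congr 1
  field_simp

/-- Any distribution map `π : Θ → interior of the simplex on a finite
action set 𝒜` can be realized by a random-cost utility maximization model: there are
benefits `B_a(θ)` and random costs `C_a` on some probability space such that for every `θ`
the maximizer of `a ↦ B_a(θ) - C_a` is almost surely unique, and the probability that `a`
is the (unique) argmax equals `π_a(θ)`. -/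
theorem microfoundation_realizes_any_distribution_map
    {𝒜 Θ : Type*} [Fintype 𝒜] [Nontrivial 𝒜] [Nonempty Θ]
    (π : Θ → 𝒜 → ℝ)
    (hpos : ∀ θ a, 0 < π θ a)
    (hsum : ∀ θ, ∑ a, π θ a = 1) :
    ∃ (Ω : Type) (_ : MeasurableSpace Ω) (P : Measure Ω) (_ : IsProbabilityMeasure P)
      (B : Θ → 𝒜 → ℝ) (C : Ω → 𝒜 → ℝ),
      ∀ θ : Θ,
        P {ω | ∃! a : 𝒜, ∀ a' : 𝒜, B θ a' - C ω a' ≤ B θ a - C ω a} = 1 ∧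
        ∀ a : 𝒜,
          P {ω | (∀ a' : 𝒜, B θ a' - C ω a' ≤ B θ a - C ω a) ∧
                 (∀ a' : 𝒜, B θ a' - C ω a' = B θ a - C ω a → a' = a)}
            = ENNReal.ofReal (π θ a) := by
  classical
  obtain ⟨n, ⟨e⟩⟩ : ∃ n, Nonempty (𝒜 ≃ Fin (n + 1)) :=
    ⟨Fintype.card 𝒜 - 1, ⟨Fintype.equivFinOfCardEq (Nat.sub_add_cancel Fintype.card_pos).symm⟩⟩
  have := isProbabilityMeasure_expMeasure one_pos
  refine ⟨Fin (n + 1) → ℝ, inferInstance, Measure.pi fun _ ↦ expMeasure 1, inferInstance,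
    fun θ a ↦ Real.log (π θ a), fun ω a ↦ Real.log (ω (e a)), fun θ ↦ ?_⟩
  have hω : ∀ᵐ ω ∂(Measure.pi fun _ : Fin (n + 1) ↦ expMeasure 1), ∀ j, 0 < ω j :=
    ae_all_iff.2 fun j ↦ (measurePreserving_eval (fun _ : Fin (n + 1) ↦ expMeasure 1)
      j).quasiMeasurePreserving.ae (ae_pos_expMeasure one_pos)
  set S : 𝒜 → Set (Fin (n + 1) → ℝ) := fun a ↦
    {ω | (∀ a', Real.log (π θ a') - Real.log (ω (e a')) ≤
            Real.log (π θ a) - Real.log (ω (e a))) ∧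
         ∀ a', Real.log (π θ a') - Real.log (ω (e a')) =
            Real.log (π θ a) - Real.log (ω (e a)) → a' = a} with hS
  have hSmeas (a : 𝒜) : MeasurableSet (S a) := by
    simp only [hS, Set.ofPred_and, Set.ofPred_forall]
    refine .inter (.iInter fun a' ↦ measurableSet_le (by fun_prop) (by fun_prop))
      (.iInter fun a' ↦ ?_)
    by_cases h : a' = a
    · simp [h]
    · simp only [h, imp_false]
      exact (measurableSet_eq_fun (by fun_prop) (by fun_prop)).compl
  have hSprob (a : 𝒜) : Measure.pi (fun _ ↦ expMeasure 1) (S a) = ENNReal.ofReal (π θ a) := by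
    have hrace := pi_expMeasure_race (fun j ↦ π θ (e.symm j)) (fun j ↦ hpos θ _) (e a)
    rw [e.symm.sum_comp (π θ), hsum, div_one, e.symm_apply_apply] at hrace
    rw [← hrace]
    refine measure_congr ?_
    filter_upwards [hω] with ω hω
    refine propext ?_
    change ((∀ a', _) ∧ ∀ a', _) ↔ ∀ j ≠ e a, _
    have hlt (a' : 𝒜) : ω (e a) / π θ a < ω (e a') / π θ a' ↔
        Real.log (π θ a') - Real.log (ω (e a')) < Real.log (π θ a) - Real.log (ω (e a)) := by
      rw [← Real.log_lt_log_iff (div_pos (hω _) (hpos θ _)) (div_pos (hω _) (hpos θ _)),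
        Real.log_div (hω _).ne' (hpos θ _).ne', Real.log_div (hω _).ne' (hpos θ _).ne']
      constructor <;> intro h <;> linarith
    rw [← e.forall_congr_right]
    simp only [ne_eq, e.apply_eq_iff_eq, e.symm_apply_apply, hlt]
    refine ⟨fun h a' ha' ↦ (h.1 a').lt_of_ne fun heq ↦ ha' (h.2 a' heq), fun h ↦
      ⟨fun a' ↦ ?_, fun a' heq ↦ by_contra fun ha' ↦ (h a' ha').ne heq⟩⟩
    rcases eq_or_ne a' a with rfl | ha'
    · exact le_rfl
    · exact (h a' ha').le
  refine ⟨le_antisymm prob_le_one ?_, hSprob⟩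
  have hdisj : Pairwise (Function.onFun Disjoint S) := fun a b hab ↦
    Set.disjoint_left.2 fun ω ha hb ↦ hab (hb.2 a (le_antisymm (hb.1 a) (ha.1 b)))
  calc (1 : ENNReal) = ∑ a, ENNReal.ofReal (π θ a) := by
        rw [← ENNReal.ofReal_sum_of_nonneg fun a _ ↦ (hpos θ a).le, hsum, ENNReal.ofReal_one]
    _ = Measure.pi (fun _ ↦ expMeasure 1) (⋃ a, S a) := by
        rw [measure_iUnion hdisj hSmeas, tsum_fintype]
        exact Finset.sum_congr rfl fun a _ ↦ (hSprob a).symm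
    _ ≤ _ := by
        refine measure_mono <| Set.iUnion_subset fun a ω ha ↦ ?_
        exact ⟨a, ha.1, fun b hb ↦ ha.2 b (le_antisymm (ha.1 b) (hb a))⟩
end

section
/- Let η ∈ (0,1), α = 1/(1+η), and τ₀ ≥ 2 be an integer. For an integer K ≥ 1, set M = τ₀(2^K − 1), and for k = 1,…,K define episode lengths J_k = τ₀ 2^{k−1} and exploration lengths I_k = ⌈J_k^α⌉. Then there exists a constant C > 0 (depending only on τ₀ and η) such that for all K ≥ 1: Σ_{k=1}^K I_k + Σ_{k=1}^K J_k · (log(max(I_k, 2)) / I_k)^η ≤ C · M^{1/(1+η)} · (1 + log M)^η. -/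
/-- Length `|𝒥_k| = τ₀ 2^{k-1}` of episode `k` in the doubling-trick algorithm. -/
def episodeLen (τ₀ k : ℕ) : ℕ := τ₀ * 2 ^ (k - 1)

/-- Length `|ℐ_k| = ⌈|𝒥_k|^α⌉` of the exploration phase of episode `k`. -/
noncomputable def exploreLen (τ₀ : ℕ) (α : ℝ) (k : ℕ) : ℕ :=
  ⌈(episodeLen τ₀ k : ℝ) ^ α⌉₊

lemma two_le_episodeLen {τ₀ : ℕ} (hτ₀ : 2 ≤ τ₀) (k : ℕ) : 2 ≤ episodeLen τ₀ k :=
  hτ₀.trans (Nat.le_mul_of_pos_right _ (by positivity))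

lemma episodeLen_mono (τ₀ : ℕ) : Monotone (episodeLen τ₀) := fun _ _ h =>
  Nat.mul_le_mul_left _ (Nat.pow_le_pow_right two_pos (Nat.sub_le_sub_right h 1))

lemma episodeLen_succ (τ₀ : ℕ) {k : ℕ} (hk : 1 ≤ k) :
    episodeLen τ₀ (k + 1) = 2 * episodeLen τ₀ k := by
  obtain ⟨j, rfl⟩ := Nat.exists_eq_add_of_le' hk
  simp only [episodeLen, Nat.add_sub_cancel, pow_succ]
  ring

/-- The last episode is no longer than the whole horizon. -/
lemma episodeLen_le_horizon (τ₀ : ℕ) {K : ℕ} (hK : 1 ≤ K) :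
    episodeLen τ₀ K ≤ τ₀ * (2 ^ K - 1) := by
  obtain ⟨j, rfl⟩ := Nat.exists_eq_add_of_le' hK
  refine Nat.mul_le_mul_left _ ?_
  have : 1 ≤ 2 ^ j := Nat.one_le_two_pow
  rw [Nat.add_sub_cancel, pow_succ]
  omega

/-- A sum of positive powers of the episode lengths is dominated by its last term. -/
lemma sum_episodeLen_rpow_le (τ₀ : ℕ) {α : ℝ} (hα : 0 < α) {K : ℕ} (hK : 1 ≤ K) :
    ∑ k ∈ Finset.Icc 1 K, (episodeLen τ₀ k : ℝ) ^ α ≤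
      (2 : ℝ) ^ α / (2 ^ α - 1) * (episodeLen τ₀ K : ℝ) ^ α := by
  have hr : 0 < (2 : ℝ) ^ α - 1 := sub_pos.2 (Real.one_lt_rpow one_lt_two hα)
  induction K, hK using Nat.le_induction with
  | base =>
    rw [Finset.Icc_self, Finset.sum_singleton]
    refine le_mul_of_one_le_left (by positivity) ?_
    rw [one_le_div hr]
    linarith
  | succ K hK ih =>
    rw [Finset.sum_Icc_succ_top (by omega), episodeLen_succ τ₀ hK, Nat.cast_mul, Nat.cast_two,
      Real.mul_rpow zero_le_two (Nat.cast_nonneg _)]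
    refine (add_le_add_left ih _).trans_eq ?_
    field_simp
    ring

lemma rpow_le_exploreLen (τ₀ : ℕ) (α : ℝ) (k : ℕ) :
    (episodeLen τ₀ k : ℝ) ^ α ≤ exploreLen τ₀ α k :=
  Nat.le_ceil _

lemma exploreLen_le_two_mul_rpow {τ₀ : ℕ} (hτ₀ : 2 ≤ τ₀) {α : ℝ} (hα : 0 ≤ α) (k : ℕ) :
    (exploreLen τ₀ α k : ℝ) ≤ 2 * (episodeLen τ₀ k : ℝ) ^ α := by
  have hJ : (1 : ℝ) ≤ episodeLen τ₀ k :=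
    mod_cast one_le_two.trans (two_le_episodeLen hτ₀ k)
  have h := (Nat.ceil_lt_add_one (a := (episodeLen τ₀ k : ℝ) ^ α) (by positivity)).le
  have := Real.one_le_rpow hJ hα
  unfold exploreLen
  linarith

lemma exploreLen_le_episodeLen {τ₀ : ℕ} (hτ₀ : 2 ≤ τ₀) {α : ℝ} (hα : α ≤ 1) (k : ℕ) :
    exploreLen τ₀ α k ≤ episodeLen τ₀ k := by
  have hJ : (1 : ℝ) ≤ episodeLen τ₀ k :=
    mod_cast one_le_two.trans (two_le_episodeLen hτ₀ k)
  exact Nat.ceil_le.2 (Real.rpow_le_self_of_one_le hJ hα)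

/-- The choice `α = 1 / (1 + η)` makes the exploitation cost of an episode comparable to the
length of its exploration phase, up to a logarithmic factor. -/
lemma exploitation_cost_le {η : ℝ} (hη : 0 < η) {τ₀ : ℕ} (hτ₀ : 2 ≤ τ₀) (k : ℕ) :
    (episodeLen τ₀ k : ℝ) *
        (Real.log (max (exploreLen τ₀ (1 / (1 + η)) k : ℝ) 2) /
          (exploreLen τ₀ (1 / (1 + η)) k : ℝ)) ^ η ≤
      (episodeLen τ₀ k : ℝ) ^ (1 / (1 + η)) * Real.log (episodeLen τ₀ k) ^ η := by
  have hI := rpow_le_exploreLen τ₀ (1 / (1 + η)) k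
  have hIJ : (exploreLen τ₀ (1 / (1 + η)) k : ℝ) ≤ episodeLen τ₀ k :=
    mod_cast exploreLen_le_episodeLen hτ₀ (by rw [div_le_one (by positivity)]; linarith) k
  have hJ2 : (2 : ℝ) ≤ episodeLen τ₀ k := mod_cast two_le_episodeLen hτ₀ k
  generalize (episodeLen τ₀ k : ℝ) = J at *
  generalize (exploreLen τ₀ (1 / (1 + η)) k : ℝ) = I at *
  have hJ : 0 < J := two_pos.trans_le hJ2
  have hJα : 0 < J ^ (1 / (1 + η)) := by positivity
  have hlogI : 0 ≤ Real.log (max I 2) := Real.log_nonneg (one_le_two.trans (le_max_right _ _))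
  have hlogJ : 0 ≤ Real.log J := Real.log_nonneg (by linarith)
  have hlog : Real.log (max I 2) ≤ Real.log J :=
    Real.log_le_log (by positivity) (max_le hIJ hJ2)
  calc J * (Real.log (max I 2) / I) ^ η
      ≤ J * (Real.log J / J ^ (1 / (1 + η))) ^ η := by
        refine mul_le_mul_of_nonneg_left ?_ hJ.le
        exact Real.rpow_le_rpow (div_nonneg hlogI (hJα.le.trans hI))
          (div_le_div₀ hlogJ hlog hJα hI) hη.le
    _ = J / J ^ (1 / (1 + η) * η) * Real.log J ^ η := by
        rw [Real.div_rpow hlogJ hJα.le, ← Real.rpow_mul hJ.le]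
        ring
    _ = J ^ (1 / (1 + η)) * Real.log J ^ η := by
        congr 1
        rw [div_eq_iff (by positivity), ← Real.rpow_add hJ]
        have : 1 / (1 + η) + 1 / (1 + η) * η = 1 := by field_simp
        rw [this, Real.rpow_one]

/-- Deterministic core of the doubling-trick regret analysis: with
`η ∈ (0,1)`, `α = 1/(1+η)`, `τ₀ ≥ 2`, `M = τ₀(2^K - 1)`, `J_k = τ₀ 2^{k-1}` and
`I_k = ⌈J_k^α⌉`, there is a constant `C > 0` (depending only on `τ₀, η`) such that
`Σ_k I_k + Σ_k J_k (log(max(I_k,2)) / I_k)^η ≤ C M^{1/(1+η)} (1 + log M)^η` for all `K ≥ 1`. -/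
theorem doubling_trick_regret_sums_bound
    (η : ℝ) (hη : η ∈ Set.Ioo (0 : ℝ) 1) (α : ℝ) (hα : α = 1 / (1 + η))
    (τ₀ : ℕ) (hτ₀ : 2 ≤ τ₀) :
    ∃ C > (0 : ℝ), ∀ K : ℕ, 1 ≤ K →
      (∑ k ∈ Finset.Icc 1 K, (exploreLen τ₀ α k : ℝ)) +
        ∑ k ∈ Finset.Icc 1 K, (episodeLen τ₀ k : ℝ) *
          (Real.log (max (exploreLen τ₀ α k : ℝ) 2) / (exploreLen τ₀ α k : ℝ)) ^ η
      ≤ C * ((τ₀ * (2 ^ K - 1) : ℕ) : ℝ) ^ ((1 : ℝ) / (1 + η)) *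
          (1 + Real.log ((τ₀ * (2 ^ K - 1) : ℕ) : ℝ)) ^ η := by
  have hη₀ : 0 < η := hη.1
  have hα₀ : 0 < 1 / (1 + η) := by positivity
  subst hα
  have hr : 0 < (2 : ℝ) ^ (1 / (1 + η)) - 1 := sub_pos.2 (Real.one_lt_rpow one_lt_two hα₀)
  refine ⟨3 * ((2 : ℝ) ^ (1 / (1 + η)) / (2 ^ (1 / (1 + η)) - 1)), by positivity,
    fun K hK => ?_⟩
  have hM (k : ℕ) (hk : k ≤ K) : (episodeLen τ₀ k : ℝ) ≤ (τ₀ * (2 ^ K - 1) : ℕ) :=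
    mod_cast (episodeLen_mono τ₀ hk).trans (episodeLen_le_horizon τ₀ hK)
  have hJ2 (k : ℕ) : (2 : ℝ) ≤ episodeLen τ₀ k := mod_cast two_le_episodeLen hτ₀ k
  generalize ((τ₀ * (2 ^ K - 1) : ℕ) : ℝ) = M at hM ⊢
  have hL : 0 ≤ Real.log M := Real.log_nonneg (by linarith [hM K le_rfl, hJ2 K])
  have hLη : 1 ≤ (1 + Real.log M) ^ η := Real.one_le_rpow (by linarith) hη₀.le
  have hterm (k : ℕ) (hk : k ∈ Finset.Icc 1 K) :
      (exploreLen τ₀ (1 / (1 + η)) k : ℝ) + (episodeLen τ₀ k : ℝ) *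
        (Real.log (max (exploreLen τ₀ (1 / (1 + η)) k : ℝ) 2) /
          (exploreLen τ₀ (1 / (1 + η)) k : ℝ)) ^ η ≤
      3 * (1 + Real.log M) ^ η * (episodeLen τ₀ k : ℝ) ^ (1 / (1 + η)) := by
    have hJ : 0 < (episodeLen τ₀ k : ℝ) := two_pos.trans_le (hJ2 k)
    have hlog : Real.log (episodeLen τ₀ k) ≤ 1 + Real.log M := by
      linarith [Real.log_le_log hJ (hM k (Finset.mem_Icc.1 hk).2)]
    have hlogη := Real.rpow_le_rpow (Real.log_natCast_nonneg _) hlog hη₀.le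
    have hJα : 0 ≤ (episodeLen τ₀ k : ℝ) ^ (1 / (1 + η)) := by positivity
    linarith [exploreLen_le_two_mul_rpow hτ₀ hα₀.le k, exploitation_cost_le hη₀ hτ₀ k,
      mul_le_mul_of_nonneg_left hlogη hJα, mul_le_mul_of_nonneg_left hLη hJα]
  have hlast : (episodeLen τ₀ K : ℝ) ^ (1 / (1 + η)) ≤ M ^ (1 / (1 + η)) :=
    Real.rpow_le_rpow (Nat.cast_nonneg _) (hM K le_rfl) hα₀.le
  rw [← Finset.sum_add_distrib]
  refine (Finset.sum_le_sum hterm).trans ?_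
  rw [← Finset.mul_sum]
  calc 3 * (1 + Real.log M) ^ η *
        ∑ k ∈ Finset.Icc 1 K, (episodeLen τ₀ k : ℝ) ^ (1 / (1 + η))
      ≤ 3 * (1 + Real.log M) ^ η *
        ((2 : ℝ) ^ (1 / (1 + η)) / (2 ^ (1 / (1 + η)) - 1) * M ^ (1 / (1 + η))) := by
        refine mul_le_mul_of_nonneg_left ((sum_episodeLen_rpow_le τ₀ hα₀ hK).trans ?_)
          (by positivity)
        exact mul_le_mul_of_nonneg_left hlast (by positivity)
    _ = _ := by ring
end
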